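/- Let n ≥ 1, m ≥ 1, 0 < p < ∞, s_1,…,s_m > −1, and let μ be a positive Borel measure on ℝ^{n+1}_+. Suppose there is a constant C > 0 such that μ(Q_w) ≤ C·s^{m(n+1)+s_1+⋯+s_m} for every w = (y,s) ∈ ℝ^{n+1}_+. Then there is a constant C' > 0 such that for every function f harmonic on (ℝ^{n+1}_+)^m one has ∫_{ℝ^{n+1}_+} |f(z,…,z)|^p dμ(z) ≤ C' ∫_{ℝ^{n+1}_+}⋯∫_{ℝ^{n+1}_+} |f(z_1,…,z_m)|^p dm_{s_1}(z_1)⋯dm_{s_m}(z_m). -/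

import Mathlib

open MeasureTheory Real Set
open scoped ENNReal

noncomputable section

abbrev Euc (N : ℕ) : Type := EuclideanSpace ℝ (Fin N)

/-- The point `(x, t) ∈ ℝ^{n+1}`. -/
def pt {n : ℕ} (x : Euc n) (t : ℝ) : Euc (n + 1) :=
  (EuclideanSpace.equiv (Fin (n + 1)) ℝ).symm (Fin.snoc (fun i => x i) t)

/-- horizontal part of a point of ℝ^{n+1} -/
def xp {n : ℕ} (z : Euc (n + 1)) : Euc n :=
  (EuclideanSpace.equiv (Fin n) ℝ).symm (fun i => z i.castSucc)

/-- vertical part of a point of ℝ^{n+1} -/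
def tp {n : ℕ} (z : Euc (n + 1)) : ℝ := z (Fin.last n)

/-- The upper half space ℝ^{n+1}_+. -/
def upperHS (n : ℕ) : Set (Euc (n + 1)) := {z | 0 < tp z}

/-- |z - w̄| where z = (x,t), w̄ = (y, -s): Euclidean distance -/
def dB {n : ℕ} (x : Euc n) (t : ℝ) (y : Euc n) (s : ℝ) : ℝ :=
  dist (pt x t) (pt y (-s))

/-- the measure t^λ dx dt on ℝ^n × (0,∞), identified with ℝ^{n+1}_+ -/
def mLam (n : ℕ) (l : ℝ) : Measure (Euc n × ℝ) :=
  ((volume : Measure (Euc n)).prod ((volume : Measure ℝ).restrict (Ioi 0))).withDensity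
    (fun zt => ENNReal.ofReal (zt.2 ^ l))

/-- second derivative of `f` at `z` along direction `v` -/
def d2 {V : Type*} [NormedAddCommGroup V] [NormedSpace ℝ V] (f : V → ℝ) (z v : V) : ℝ :=
  iteratedFDeriv ℝ 2 f z ![v, v]

/-- `f` is harmonic on a subset of ℝ^N : twice continuously differentiable with
vanishing Laplacian. -/
def HarmonicOnE {N : ℕ} (f : Euc N → ℝ) (s : Set (Euc N)) : Prop :=
  ContDiffOn ℝ 2 f s ∧ ∀ z ∈ s, ∑ i, d2 f z (EuclideanSpace.single i 1) = 0

/-- `f` is harmonic on (ℝ^{n+1}_+)^m, viewed as an open subset of ℝ^{m(n+1)}. -/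
def HarmonicOnM {n m : ℕ} (f : (Fin m → Euc (n + 1)) → ℝ) : Prop :=
  ContDiffOn ℝ 2 f {z | ∀ j, z j ∈ upperHS n} ∧
  ∀ z ∈ {z : Fin m → Euc (n + 1) | ∀ j, z j ∈ upperHS n},
    ∑ j, ∑ i, d2 f z (Function.update (0 : Fin m → Euc (n + 1)) j (EuclideanSpace.single i 1)) = 0

/-- `f` is harmonic in each variable separately on (ℝ^{n+1}_+)^m -/
def HarmonicSep {n m : ℕ} (f : (Fin m → Euc (n + 1)) → ℝ) : Prop :=
  ∀ (j : Fin m) (z : Fin m → Euc (n + 1)), (∀ k, z k ∈ upperHS n) →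
    HarmonicOnE (fun w => f (Function.update z j w)) (upperHS n)

/-- the closed cube centered at (y,s) with side length s -/
def Qcube {n : ℕ} (y : Euc n) (s : ℝ) : Set (Euc (n + 1)) :=
  {z | (∀ i : Fin n, |z (Fin.castSucc i) - y i| ≤ s / 2) ∧ |tp z - s| ≤ s / 2}

/-- the A^p_λ (quasi)-norm, raised to the power p -/
def normAp (n : ℕ) (f : Euc (n + 1) → ℝ) (p l : ℝ) : ℝ≥0∞ :=
  ∫⁻ zt : Euc n × ℝ, ENNReal.ofReal (|f (pt zt.1 zt.2)| ^ p) ∂(mLam n l)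

/-- membership in the harmonic Bergman space A^p_λ -/
def memAp (n : ℕ) (f : Euc (n + 1) → ℝ) (p l : ℝ) : Prop :=
  HarmonicOnE f (upperHS n) ∧ normAp n f p l < ⊤

open scoped Topology NNReal

lemma hasDerivAt_max_zero_sq (u : ℝ) :
    HasDerivAt (fun u : ℝ => (max 0 u) ^ 2) (2 * max 0 u) u := by
  rcases lt_trichotomy u 0 with h | h | h
  · have : (fun u : ℝ => (max 0 u) ^ 2) =ᶠ[𝓝 u] fun _ => 0 := by
      filter_upwards [gt_mem_nhds h] with v hv
      simp [max_eq_left hv.le]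
    rw [max_eq_left h.le, mul_zero]
    exact (hasDerivAt_const u 0).congr_of_eventuallyEq this
  · subst h
    rw [hasDerivAt_iff_isLittleO]
    have h2 : (fun u : ℝ => u ^ 2) =o[𝓝 0] fun u : ℝ => u := by
      simpa using Asymptotics.isLittleO_pow_pow (𝕜 := ℝ) (m := 1) (n := 2) (by norm_num)
    refine (Asymptotics.IsBigO.of_bound 1 (Filter.Eventually.of_forall fun v => ?_)).trans_isLittleO
      (h2.congr_right fun v => (sub_zero v).symm)
    have : |max 0 v| ≤ |v| := by
      rcases le_total 0 v with h | h <;> simp [h]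
    simpa using sq_le_sq.2 this
  · have : (fun u : ℝ => (max 0 u) ^ 2) =ᶠ[𝓝 u] fun v => v ^ 2 := by
      filter_upwards [lt_mem_nhds h] with v hv
      simp [max_eq_right hv.le]
    rw [max_eq_right h.le]
    simpa using (hasDerivAt_pow 2 u).congr_of_eventuallyEq this

section MeanValue

variable {E : Type*} [NormedAddCommGroup E]

/-- The radial weight `x ↦ (1 - ‖x‖²)₊`. -/
def radialWeight (x : E) : ℝ := max 0 (1 - ‖x‖ ^ 2)

/-- A function whose gradient at `x` is `radialWeight x • x`. -/
def radialPotential (x : E) : ℝ := -(1 / 4) * (max 0 (1 - ‖x‖ ^ 2)) ^ 2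

lemma radialWeight_nonneg (x : E) : 0 ≤ radialWeight x := le_max_left _ _

lemma radialWeight_le_one (x : E) : radialWeight x ≤ 1 :=
  max_le zero_le_one (by nlinarith [sq_nonneg ‖x‖])

lemma radialWeight_eq_zero {x : E} (hx : 1 ≤ ‖x‖) : radialWeight x = 0 :=
  max_eq_left (by nlinarith)

lemma radialPotential_eq_zero {x : E} (hx : 1 ≤ ‖x‖) : radialPotential x = 0 := by
  simp [radialPotential, max_eq_left (show 1 - ‖x‖ ^ 2 ≤ 0 by nlinarith)]

lemma continuous_radialWeight : Continuous (radialWeight : E → ℝ) := by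
  unfold radialWeight; fun_prop

lemma continuous_radialPotential : Continuous (radialPotential : E → ℝ) := by
  unfold radialPotential; fun_prop

variable [InnerProductSpace ℝ E]

lemma hasFDerivAt_radialPotential (x : E) :
    HasFDerivAt (radialPotential : E → ℝ) (radialWeight x • innerSL ℝ x) x := by
  have h1 : HasFDerivAt (fun y : E => 1 - ‖y‖ ^ 2) (-(2 • innerSL ℝ x)) x :=
    (hasStrictFDerivAt_norm_sq x).hasFDerivAt.const_sub 1
  have h2 := ((hasDerivAt_max_zero_sq (1 - ‖x‖ ^ 2)).comp_hasFDerivAt x h1).const_mul (-(1 / 4))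
  refine h2.congr_fderiv ?_
  ext v
  simp [radialWeight]
  ring

variable [FiniteDimensional ℝ E]

lemma hasCompactSupport_radialWeight : HasCompactSupport (radialWeight : E → ℝ) :=
  HasCompactSupport.intro (isCompact_closedBall 0 1) fun x hx =>
    radialWeight_eq_zero (by simpa using (not_le.1 (by simpa using hx)).le)

lemma hasCompactSupport_radialPotential : HasCompactSupport (radialPotential : E → ℝ) :=
  HasCompactSupport.intro (isCompact_closedBall 0 1) fun x hx =>
    radialPotential_eq_zero (by simpa using (not_le.1 (by simpa using hx)).le)

/-- A cutoff turns a function harmonic near a closed ball into a compactly supported `C²` function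
which agrees with it on the concentric ball of half the radius. -/
lemma exists_contDiff_hasCompactSupport_eqOn {f : E → ℝ} {U : Set E} (hU : IsOpen U)
    (hf : ContDiffOn ℝ 2 f U) {a : E} {r : ℝ} (hr : 0 < r) (ha : Metric.closedBall a (2 * r) ⊆ U) :
    ∃ g : E → ℝ, ContDiff ℝ 2 g ∧ HasCompactSupport g ∧ EqOn g f (Metric.ball a r) := by
  let χ : ContDiffBump a := ⟨r, 2 * r, hr, by linarith⟩
  refine ⟨fun x => χ x * f x, contDiff_iff_contDiffAt.2 fun x => ?_,
    χ.hasCompactSupport.mul_right, fun x hx => ?_⟩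
  · by_cases hx : x ∈ U
    · exact χ.contDiffAt.mul (hf.contDiffAt (hU.mem_nhds hx))
    · have hx' : x ∉ tsupport χ := fun h => hx (ha (by rwa [χ.tsupport_eq] at h))
      refine contDiffAt_const (c := 0) |>.congr_of_eventuallyEq ?_
      filter_upwards [(isClosed_tsupport χ).isOpen_compl.mem_nhds hx'] with y hy
      simp [image_eq_zero_of_notMem_tsupport hy]
  · simp [χ.one_of_mem_closedBall (Metric.ball_subset_closedBall hx)]

variable [MeasurableSpace E] [BorelSpace E] (μ : Measure E) [μ.IsAddHaarMeasure]

lemma integral_radialWeight_pos : 0 < ∫ x : E, radialWeight x ∂μ :=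
  continuous_radialWeight.integral_pos_of_hasCompactSupport_nonneg_nonzero
    hasCompactSupport_radialWeight radialWeight_nonneg (x := 0) (by simp [radialWeight])

/-- Divergence theorem: the radial derivative of `f` along dilations, weighted radially, integrates
to zero where `f` is harmonic. -/
lemma integral_fderiv_mul_radialWeight_eq_zero {ι : Type*} [Fintype ι] (b : OrthonormalBasis ι ℝ E)
    {f : E → ℝ} (hf : ContDiff ℝ 2 f) {a : E} {r t : ℝ}
    (ht : t ∈ Icc 0 r)
    (hΔ : ∀ x ∈ Metric.ball a r, ∑ i, fderiv ℝ (fderiv ℝ f) x (b i) (b i) = 0) :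
    ∫ x, fderiv ℝ f (a + t • x) x * radialWeight x ∂μ = 0 := by
  have hf1 : ContDiff ℝ 1 (fderiv ℝ f) := hf.fderiv_right (by norm_num)
  have hf2 : Continuous (fderiv ℝ (fderiv ℝ f)) := hf1.continuous_fderiv (by norm_num)
  have hf1c := hf1.continuous
  have hpart (i : ι) : ∫ x, fderiv ℝ f (a + t • x) (b i) * (radialWeight x * inner ℝ x (b i)) ∂μ
      = - ∫ x, t * fderiv ℝ (fderiv ℝ f) (a + t • x) (b i) (b i) * radialPotential x ∂μ := by
    have hg (x : E) : HasFDerivAt (fun x => fderiv ℝ f (a + t • x) (b i))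
        (t • (fderiv ℝ (fderiv ℝ f) (a + t • x)).flip (b i)) x := by
      have h1 : HasFDerivAt (fun x : E => a + t • x) (t • ContinuousLinearMap.id ℝ E) x :=
        ((hasFDerivAt_id x).const_smul t).const_add a
      have h2 := ((hf1.differentiable (by norm_num)) (a + t • x)).hasFDerivAt.comp x h1
      refine (h2.clm_apply (hasFDerivAt_const (b i) x)).congr_fderiv ?_
      ext v
      simp
    have := integral_bilinear_hasFDerivAt_right_eq_neg_left_of_integrable (μ := μ)
      (B := ContinuousLinearMap.mul ℝ ℝ) (v := b i)
      (f := fun x => fderiv ℝ f (a + t • x) (b i)) (g := radialPotential) 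
      (f' := fun x => t • (fderiv ℝ (fderiv ℝ f) (a + t • x)).flip (b i))
      (g' := fun x => radialWeight x • innerSL ℝ x) ?_ ?_ ?_ (fun x _ => hg x)
      (fun x _ => hasFDerivAt_radialPotential x)
    · simpa using this
    · refine Continuous.integrable_of_hasCompactSupport ?_ ?_
      · have := continuous_radialPotential (E := E)
        simp only [ContinuousLinearMap.mul_apply', smul_apply,
          ContinuousLinearMap.flip_apply]
        fun_prop
      · exact hasCompactSupport_radialPotential.mul_left
    · refine Continuous.integrable_of_hasCompactSupport ?_ ?_
      · have := continuous_radialWeight (E := E)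
        simp only [ContinuousLinearMap.mul_apply', smul_apply,
          innerSL_apply_apply]
        fun_prop
      · simp only [smul_apply, ContinuousLinearMap.mul_apply', smul_eq_mul]
        exact (hasCompactSupport_radialWeight.mul_right).mul_left
    · refine Continuous.integrable_of_hasCompactSupport ?_ ?_
      · have := continuous_radialPotential (E := E)
        simp only [ContinuousLinearMap.mul_apply']
        fun_prop
      · exact hasCompactSupport_radialPotential.mul_left
  have hsum (x : E) : fderiv ℝ f (a + t • x) x * radialWeight x =
      ∑ i, fderiv ℝ f (a + t • x) (b i) * (radialWeight x * inner ℝ x (b i)) := by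
    conv_lhs => rw [show fderiv ℝ f (a + t • x) x =
      fderiv ℝ f (a + t • x) (∑ i, inner ℝ (b i) x • b i) by rw [b.sum_repr']]
    simp only [map_sum, map_smul, smul_eq_mul, Finset.sum_mul, real_inner_comm x]
    exact Finset.sum_congr rfl fun i _ => by ring
  simp_rw [hsum]
  rw [integral_finsetSum]
  · simp_rw [hpart]
    rw [Finset.sum_neg_distrib, ← integral_finsetSum]
    · rw [neg_eq_zero]
      refine integral_eq_zero_of_ae (Filter.Eventually.of_forall fun x => ?_)
      simp only [Pi.zero_apply, ← Finset.sum_mul, ← Finset.mul_sum]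
      rcases lt_or_ge ‖x‖ 1 with hx | hx
      · rcases ht.1.eq_or_lt with h0 | h0
        · simp [← h0]
        · rw [hΔ]
          · simp
          · simp only [Metric.mem_ball, dist_self_add_left, norm_smul, Real.norm_eq_abs,
              abs_of_pos h0]
            nlinarith [ht.2]
      · simp [radialPotential_eq_zero hx]
    · intro i _
      refine Continuous.integrable_of_hasCompactSupport ?_ ?_
      · have := continuous_radialPotential (E := E)
        fun_prop
      · exact hasCompactSupport_radialPotential.mul_left
  · intro i _
    refine Continuous.integrable_of_hasCompactSupport ?_ ?_
    · have := continuous_radialWeight (E := E)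
      fun_prop
    · exact (hasCompactSupport_radialWeight.mul_right).mul_left

/-- Mean value property of harmonic functions with respect to a radial weight. -/
lemma integral_comp_mul_radialWeight {ι : Type*} [Fintype ι] (b : OrthonormalBasis ι ℝ E)
    {f : E → ℝ} (hf : ContDiff ℝ 2 f) (hfs : HasCompactSupport f) {a : E} {r : ℝ} (hr : 0 ≤ r)
    (hΔ : ∀ x ∈ Metric.ball a r, ∑ i, fderiv ℝ (fderiv ℝ f) x (b i) (b i) = 0) :
    ∫ x, f (a + r • x) * radialWeight x ∂μ = f a * ∫ x, radialWeight x ∂μ := by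
  have hf0 := hf.continuous
  have hf1 : Continuous (fderiv ℝ f) := hf.continuous_fderiv (by norm_num)
  have hw := continuous_radialWeight (E := E)
  obtain ⟨M, hM⟩ := (hfs.fderiv ℝ).exists_bound_of_continuous hf1
  have hM0 : 0 ≤ M := (norm_nonneg _).trans (hM 0)
  have hfi (t : ℝ) : Integrable (fun x => f (a + t • x) * radialWeight x) μ :=
    Continuous.integrable_of_hasCompactSupport (by fun_prop) hasCompactSupport_radialWeight.mul_left
  have hder (t : ℝ) : HasDerivAt (fun t => ∫ x, f (a + t • x) * radialWeight x ∂μ)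
      (∫ x, fderiv ℝ f (a + t • x) x * radialWeight x ∂μ) t := by
    refine (hasDerivAt_integral_of_dominated_loc_of_deriv_le (s := univ)
      (F := fun t x => f (a + t • x) * radialWeight x)
      (F' := fun t x => fderiv ℝ f (a + t • x) x * radialWeight x)
      (bound := fun x => M * radialWeight x) Filter.univ_mem
      (Filter.Eventually.of_forall fun t => (hfi t).aestronglyMeasurable) (hfi t)
      (Continuous.aestronglyMeasurable (by fun_prop))
      (Filter.Eventually.of_forall fun x t _ => ?_)
      ((hw.integrable_of_hasCompactSupport hasCompactSupport_radialWeight).const_mul M)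
      (Filter.Eventually.of_forall fun x t _ => ?_)).2
    · rw [norm_mul, Real.norm_of_nonneg (radialWeight_nonneg x)]
      rcases le_total 1 ‖x‖ with hx | hx
      · simp [radialWeight_eq_zero hx]
      · gcongr
        · exact radialWeight_nonneg x
        · exact ((fderiv ℝ f (a + t • x)).le_opNorm x).trans
            ((mul_le_mul (hM _) hx (norm_nonneg _) hM0).trans_eq (mul_one M))
    · have h1 : HasDerivAt (fun t : ℝ => a + t • x) x t := by
        simpa using ((hasDerivAt_id t).smul_const x).const_add a
      exact ((hf.differentiable (by norm_num) _).hasFDerivAt.comp_hasDerivAt t h1).mul_const _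
  have hconst := constant_of_has_deriv_right_zero (a := 0) (b := r)
    (f := fun t => ∫ x, f (a + t • x) * radialWeight x ∂μ)
    (fun t _ => (hder t).continuousAt.continuousWithinAt)
    (fun t ht => by
      have h := (hder t).hasDerivWithinAt (s := Ici t)
      rwa [integral_fderiv_mul_radialWeight_eq_zero μ b hf ⟨ht.1, ht.2.le⟩ hΔ] at h)
    r ⟨hr, le_rfl⟩
  simpa [integral_const_mul] using hconst

/-- Solid sub-mean-value inequality for harmonic functions. -/
lemma exists_abs_le_integral_abs_of_harmonic {ι : Type*} [Fintype ι]
    (b : OrthonormalBasis ι ℝ E) :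
    ∃ K : ℝ, 0 < K ∧ ∀ (f : E → ℝ) (U : Set E), IsOpen U → ContDiffOn ℝ 2 f U →
      (∀ x ∈ U, ∑ i, fderiv ℝ (fderiv ℝ f) x (b i) (b i) = 0) → ∀ (a : E) (r : ℝ), 0 < r →
      Metric.closedBall a (2 * r) ⊆ U →
      |f a| ≤ K * (r ^ Module.finrank ℝ E)⁻¹ * ∫ x in Metric.ball a r, |f x| ∂μ := by
  have hI := integral_radialWeight_pos (E := E) μ
  refine ⟨(∫ x : E, radialWeight x ∂μ)⁻¹, inv_pos.2 hI, fun f U hU hf hΔ a r hr ha => ?_⟩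
  obtain ⟨g, hg, hgs, hgf⟩ := exists_contDiff_hasCompactSupport_eqOn hU hf hr ha
  have hsub : Metric.ball a r ⊆ U := fun x hx =>
    ha (Metric.closedBall_subset_closedBall (by linarith) (Metric.ball_subset_closedBall hx))
  have hgΔ : ∀ x ∈ Metric.ball a r, ∑ i, fderiv ℝ (fderiv ℝ g) x (b i) (b i) = 0 := by
    intro x hx
    rw [← hΔ x (hsub hx)]
    have h : g =ᶠ[𝓝 x] f := hgf.eventuallyEq_of_mem (Metric.isOpen_ball.mem_nhds hx)
    rw [h.fderiv.fderiv_eq]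
  have hmv := integral_comp_mul_radialWeight μ b hg hgs hr.le hgΔ
  have hgc := hg.continuous
  have hw := continuous_radialWeight (E := E)
  have hscale : ∫ x, |g (a + r • x)| * radialWeight x ∂μ =
      (r ^ Module.finrank ℝ E)⁻¹ * ∫ y, |g y| * radialWeight (r⁻¹ • (y - a)) ∂μ := by
    have h1 := Measure.integral_comp_smul μ
      (fun y => |g (a + y)| * radialWeight (r⁻¹ • y)) r
    have h2 := integral_add_left_eq_self (μ := μ)
      (fun y => |g y| * radialWeight (r⁻¹ • (y - a))) a
    simp only [add_sub_cancel_left] at h2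
    rw [h2, abs_of_pos (by positivity)] at h1
    simpa [smul_smul, inv_mul_cancel₀ hr.ne'] using h1
  have hball : ∫ y, |g y| * radialWeight (r⁻¹ • (y - a)) ∂μ ≤ ∫ x in Metric.ball a r, |f x| ∂μ := by
    rw [setIntegral_congr_fun measurableSet_ball (g := fun x => |g x|)
      (fun x hx => by simp only [hgf hx]), ← integral_indicator measurableSet_ball]
    have hgi : Integrable (fun x => |g x|) μ :=
      hgc.abs.integrable_of_hasCompactSupport hgs.norm
    refine integral_mono_of_nonneg
      (Filter.Eventually.of_forall fun y => mul_nonneg (abs_nonneg _) (radialWeight_nonneg _))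
      (hgi.indicator measurableSet_ball) (Filter.Eventually.of_forall fun y => ?_)
    by_cases hy : y ∈ Metric.ball a r
    · simpa [hy] using mul_le_of_le_one_right (abs_nonneg (g y)) (radialWeight_le_one _)
    · have : 1 ≤ ‖r⁻¹ • (y - a)‖ := by
        rw [Metric.mem_ball, dist_eq_norm, not_lt] at hy
        rw [norm_smul, norm_inv, Real.norm_of_nonneg hr.le, ← div_eq_inv_mul, le_div_iff₀ hr]
        linarith
      simp [hy, radialWeight_eq_zero this]
  have key : |f a| * ∫ x, radialWeight x ∂μ ≤
      (r ^ Module.finrank ℝ E)⁻¹ * ∫ x in Metric.ball a r, |f x| ∂μ := by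
    rw [← hgf (Metric.mem_ball_self hr), ← abs_of_pos hI, ← abs_mul, ← hmv]
    refine (abs_integral_le_integral_abs).trans ?_
    simp only [abs_mul, abs_of_nonneg (radialWeight_nonneg _)]
    rw [hscale]
    gcongr
  rw [mul_assoc, inv_mul_eq_div, le_div_iff₀ hI]
  exact key

/-- The Hardy–Littlewood inequality: `|f|^p` has the sub-mean-value property, up to a constant, for
every `p > 0`. -/
lemma exists_abs_rpow_le_integral_abs_rpow_of_harmonic {ι : Type*} [Fintype ι] [Nontrivial E]
    (b : OrthonormalBasis ι ℝ E) {p : ℝ} (hp : 0 < p) :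
    ∃ K : ℝ, 0 < K ∧ ∀ (f : E → ℝ) (U : Set E), IsOpen U → ContDiffOn ℝ 2 f U →
      (∀ x ∈ U, ∑ i, fderiv ℝ (fderiv ℝ f) x (b i) (b i) = 0) → ∀ (a : E) (R : ℝ), 0 < R →
      Metric.closedBall a R ⊆ U →
      |f a| ^ p * R ^ Module.finrank ℝ E ≤ K * ∫ x in Metric.ball a R, |f x| ^ p ∂μ := by
  obtain ⟨K, hK, hmv⟩ := exists_abs_le_integral_abs_of_harmonic μ b
  set N := Module.finrank ℝ E
  set V := μ.real (Metric.ball (0 : E) 1)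
  have hV : 0 < V := ENNReal.toReal_pos (Metric.measure_ball_pos μ 0 one_pos).ne' measure_ball_ne_top
  set ε : ℝ := (2 * K * V)⁻¹
  have hε : 0 < ε := by positivity
  set B : ℝ := (2 ^ N : ℝ) ^ p⁻¹
  have hB : 0 < B := by positivity
  set c : ℝ := B * (ε ^ p)⁻¹
  have hc : 0 < c := by positivity
  refine ⟨2 * K * c * 4 ^ N, by positivity, fun f U hU hf hΔ a R hR ha => ?_⟩
  have hfp : ContinuousOn (fun x => |f x| ^ p) U :=
    hf.continuousOn.abs.rpow_const fun _ _ => Or.inr hp.le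
  have hfi : IntegrableOn (fun x => |f x| ^ p) (Metric.ball a R) μ :=
    ((hfp.mono ha).integrableOn_compact (isCompact_closedBall a R)).mono_set
      Metric.ball_subset_closedBall
  have hI0 : 0 ≤ ∫ x in Metric.ball a R, |f x| ^ p ∂μ :=
    integral_nonneg fun x => by positivity
  obtain ⟨x₀, hx₀, hmax⟩ := (isCompact_closedBall a R).exists_isMaxOn
    ⟨a, Metric.mem_closedBall_self hR.le⟩
    (f := fun x => |f x| ^ p * (R - dist x a) ^ N) ((hfp.mono ha).mul (by fun_prop))
  have hmax' : ∀ x ∈ Metric.closedBall a R,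
      |f x| ^ p * (R - dist x a) ^ N ≤ |f x₀| ^ p * (R - dist x₀ a) ^ N := hmax
  have hle := hmax' a (Metric.mem_closedBall_self hR.le)
  rw [dist_self, sub_zero] at hle
  refine hle.trans ?_
  set d := R - dist x₀ a
  have hd0 : 0 ≤ d := sub_nonneg.2 hx₀
  have hN : N ≠ 0 := Module.finrank_pos.ne'
  rcases (mul_nonneg (by positivity : 0 ≤ |f x₀| ^ p) (pow_nonneg hd0 N)).eq_or_lt with h0 | h0
  · rw [← h0]; positivity
  have hd : 0 < d := hd0.lt_of_ne fun h => by simp [← h, hN] at h0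
  have hA : 0 < |f x₀| := (abs_nonneg _).lt_of_ne fun h => by
    simp [← h, Real.zero_rpow hp.ne'] at h0
  set A := |f x₀|
  have hAp : 0 < A ^ p := by positivity
  have hin : ∀ y ∈ Metric.closedBall x₀ (2 * (d / 4)), d / 2 ≤ R - dist y a := by
    intro y hy
    have := dist_triangle y x₀ a
    rw [Metric.mem_closedBall] at hy
    simp only [d] at *
    linarith
  have hsub : Metric.closedBall x₀ (2 * (d / 4)) ⊆ Metric.ball a R := fun y hy => by
    have := hin y hy
    rw [Metric.mem_ball]; linarith
  have hsub' : Metric.ball x₀ (d / 4) ⊆ Metric.closedBall x₀ (2 * (d / 4)) := fun y hy =>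
    Metric.closedBall_subset_closedBall (by linarith) (Metric.ball_subset_closedBall hy)
  have hpt : ∀ y ∈ Metric.ball x₀ (d / 4), |f y| ≤ ε * A + c * A * (A ^ p)⁻¹ * |f y| ^ p := by
    intro y hy
    have h1 := hmax' y (Metric.ball_subset_closedBall (hsub (hsub' hy)))
    have h2 : |f y| ^ p * (d / 2) ^ N ≤ A ^ p * d ^ N := by
      refine le_trans ?_ h1
      gcongr
      exact hin y (hsub' hy)
    have h3 : |f y| ^ p ≤ (B * A) ^ p := by
      rw [Real.mul_rpow hB.le hA.le, ← Real.rpow_mul (by positivity), inv_mul_cancel₀ hp.ne',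
        Real.rpow_one]
      rw [div_pow, mul_div_assoc', div_le_iff₀ (by positivity)] at h2
      refine le_of_mul_le_mul_right ?_ (pow_pos hd N)
      linarith
    have h4 : |f y| ≤ B * A := (Real.rpow_le_rpow_iff (abs_nonneg _) (by positivity) hp).1 h3
    rcases le_total |f y| (ε * A) with h | h
    · exact h.trans (le_add_of_nonneg_right (by positivity))
    · have h5 : (ε * A) ^ p ≤ |f y| ^ p := Real.rpow_le_rpow (by positivity) h hp.le
      rw [Real.mul_rpow hε.le hA.le] at h5
      have : B * A ≤ c * A * (A ^ p)⁻¹ * |f y| ^ p := by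
        calc B * A = c * A * (A ^ p)⁻¹ * (ε ^ p * A ^ p) := by
              simp only [c]; field_simp
          _ ≤ _ := by gcongr
      linarith [mul_pos hε hA]
  have hfi' : IntegrableOn (fun x => |f x| ^ p) (Metric.ball x₀ (d / 4)) μ :=
    hfi.mono_set (hsub'.trans hsub)
  have hJ : ∫ x in Metric.ball x₀ (d / 4), |f x| ∂μ ≤
      ε * A * ((d / 4) ^ N * V) +
        c * A * (A ^ p)⁻¹ * ∫ x in Metric.ball a R, |f x| ^ p ∂μ := by
    calc ∫ x in Metric.ball x₀ (d / 4), |f x| ∂μ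
        ≤ ∫ x in Metric.ball x₀ (d / 4), (ε * A + c * A * (A ^ p)⁻¹ * |f x| ^ p) ∂μ := by
          refine setIntegral_mono_on ?_ ?_ measurableSet_ball hpt
          · exact ((hf.continuousOn.abs.mono
              ((hsub.trans Metric.ball_subset_closedBall).trans ha)).integrableOn_compact
                (isCompact_closedBall _ _)).mono_set hsub'
          · exact (integrableOn_const (by finiteness)).add (hfi'.const_mul _)
      _ = ε * A * ((d / 4) ^ N * V) +
          c * A * (A ^ p)⁻¹ * ∫ x in Metric.ball x₀ (d / 4), |f x| ^ p ∂μ := by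
          have hconst : Integrable (fun _ => ε * A) (μ.restrict (Metric.ball x₀ (d / 4))) :=
            integrableOn_const (by finiteness)
          rw [integral_add hconst (hfi'.const_mul _), integral_const_mul (c * A * (A ^ p)⁻¹),
            setIntegral_const, measureReal_def, μ.addHaar_ball x₀ (by positivity),
            ENNReal.toReal_mul, ENNReal.toReal_ofReal (by positivity), smul_eq_mul]
          simp only [V, measureReal_def, N]
          ring
      _ ≤ _ := by
          gcongr
          · exact Filter.Eventually.of_forall fun x => by positivity
          · exact hsub'.trans hsub
  have hmain := hmv f U hU hf hΔ x₀ (d / 4) (by positivity)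
    ((hsub.trans Metric.ball_subset_closedBall).trans ha)
  have hfin : A ≤ A / 2 + K * ((d / 4) ^ N)⁻¹ * (c * A * (A ^ p)⁻¹ *
      ∫ x in Metric.ball a R, |f x| ^ p ∂μ) := by
    refine hmain.trans ((mul_le_mul_of_nonneg_left hJ (by positivity)).trans_eq ?_)
    rw [mul_add]
    congr 1
    simp only [ε]
    field_simp
  generalize ∫ x in Metric.ball a R, |f x| ^ p ∂μ = I at *
  have : A ≤ A * ((A ^ p)⁻¹ * (d ^ N)⁻¹ * (2 * K * c * 4 ^ N * I)) := by
    have h : K * ((d / 4) ^ N)⁻¹ * (c * A * (A ^ p)⁻¹ * I) =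
        A * ((A ^ p)⁻¹ * (d ^ N)⁻¹ * (2 * K * c * 4 ^ N * I)) / 2 := by
      rw [div_pow]; field_simp
    linarith
  have h1 := (le_mul_iff_one_le_right hA).1 this
  rw [← mul_inv, inv_mul_eq_div, one_le_div (by positivity)] at h1
  exact h1

end MeanValue

lemma rpow_le_two_rpow_abs_mul_rpow {r t : ℝ} (l : ℝ) (hr : 0 < r) (ht : 0 < t) (h1 : r ≤ 2 * t)
    (h2 : t ≤ 2 * r) : r ^ l ≤ 2 ^ |l| * t ^ l := by
  have htl := Real.rpow_pos_of_pos ht l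
  rcases le_total 0 l with h | h
  · rw [abs_of_nonneg h, ← Real.mul_rpow (by norm_num) ht.le]
    exact Real.rpow_le_rpow hr.le h1 h
  · rw [abs_of_nonpos h, Real.rpow_neg (by norm_num), ← div_eq_inv_mul,
      ← Real.div_rpow ht.le (by norm_num)]
    exact Real.rpow_le_rpow_of_nonpos (by positivity) (by linarith) h

section ProductMeasure

variable {ι : Type*} [Fintype ι] {α : ι → Type*} [∀ i, MeasurableSpace (α i)]

lemma pi_le_prod_smul_pi {μ ν : ∀ i, Measure (α i)} [∀ i, SigmaFinite (μ i)]
    [∀ i, SigmaFinite (ν i)] {c : ι → ℝ≥0} (h : ∀ i, μ i ≤ c i • ν i) :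
    Measure.pi μ ≤ (∏ i, c i) • Measure.pi ν := by
  have hsmul : Measure.pi (fun i => c i • ν i) = (∏ i, c i) • Measure.pi ν := by
    refine Measure.pi_eq fun s _ => ?_
    rw [Measure.smul_apply, Measure.pi_pi, ENNReal.smul_def, smul_eq_mul, ENNReal.ofNNReal_finsetProd,
      ← Finset.prod_mul_distrib]
    rfl
  rw [← hsmul]
  refine Measure.le_iff.2 fun s hs => ?_
  have hle : (Measure.pi μ).toOuterMeasure ≤
      OuterMeasure.pi fun i => (c i • ν i).toOuterMeasure := by
    refine OuterMeasure.le_pi.2 fun t _ => ?_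
    simp only [Measure.coe_toOuterMeasure, Measure.pi_pi]
    exact Finset.prod_le_prod' fun i _ => h i (t i)
  refine (hle s).trans_eq ?_
  rw [Measure.pi_def, toMeasure_apply _ _ hs]

end ProductMeasure

section HalfSpace

variable {n m : ℕ}

lemma continuous_pt : Continuous fun z : Euc n × ℝ => pt z.1 z.2 := by
  refine (EuclideanSpace.equiv (Fin (n + 1)) ℝ).symm.continuous.comp
    (continuous_pi fun i => ?_)
  refine Fin.lastCases ?_ (fun i => ?_) i
  · simpa using continuous_snd
  · simp only [Fin.snoc_castSucc]
    fun_prop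

@[simp] lemma pt_castSucc (x : Euc n) (t : ℝ) (i : Fin n) : pt x t i.castSucc = x i := by
  simp [pt]

@[simp] lemma pt_last (x : Euc n) (t : ℝ) : pt x t (Fin.last n) = t := by
  simp [pt]

lemma continuous_tp : Continuous (tp : Euc (n + 1) → ℝ) :=
  (EuclideanSpace.proj (𝕜 := ℝ) (Fin.last n)).continuous

lemma isOpen_upperHS : IsOpen (upperHS n) := isOpen_lt continuous_const continuous_tp

instance sigmaFinite_mLam (l : ℝ) : SigmaFinite (mLam n l) := by
  unfold mLam; infer_instance

/-- Splitting a vector of `ℝ^{m(n+1)}` into `m` points of `ℝ^{n+1}`. -/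
def blockEquiv (n m : ℕ) :
    EuclideanSpace ℝ (Fin m × Fin (n + 1)) ≃L[ℝ] (Fin m → Euc (n + 1)) :=
  LinearEquiv.toContinuousLinearEquiv
    { toFun := fun x j => WithLp.toLp 2 fun i => x (j, i)
      invFun := fun z => WithLp.toLp 2 fun k => z k.1 k.2
      map_add' := fun _ _ => rfl
      map_smul' := fun _ _ => rfl
      left_inv := fun _ => rfl
      right_inv := fun _ => rfl }

/-- Splitting a vector of `ℝ^{m(n+1)}` into `m` pairs in `ℝ^n × ℝ`. -/
def blockPairEquiv (n m : ℕ) :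
    EuclideanSpace ℝ (Fin m × Fin (n + 1)) ≃L[ℝ] (Fin m → Euc n × ℝ) :=
  LinearEquiv.toContinuousLinearEquiv
    { toFun := fun x j => (WithLp.toLp 2 fun i => x (j, i.castSucc), x (j, Fin.last n))
      invFun := fun z => WithLp.toLp 2 fun k => pt (z k.1).1 (z k.1).2 k.2
      map_add' := fun _ _ => rfl
      map_smul' := fun _ _ => rfl
      left_inv := fun x => by
        ext ⟨j, i⟩
        refine Fin.lastCases ?_ (fun i => ?_) i <;> simp
      right_inv := fun z => by
        ext j <;> simp }

lemma blockEquiv_blockPairEquiv_symm (z : Fin m → Euc n × ℝ) :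
    blockEquiv n m ((blockPairEquiv n m).symm z) = fun j => pt (z j).1 (z j).2 := rfl

lemma blockEquiv_single (j : Fin m) (i : Fin (n + 1)) :
    blockEquiv n m (EuclideanSpace.single (j, i) 1) =
      Function.update (0 : Fin m → Euc (n + 1)) j (EuclideanSpace.single i 1) := by
  funext j'
  ext i'
  change (EuclideanSpace.single (j, i) (1 : ℝ)) (j', i') = _
  by_cases h : j' = j
  · subst h; simp [Prod.ext_iff]
  · simp [h, Prod.ext_iff]

lemma isOpen_pi_upperHS : IsOpen {z : Fin m → Euc (n + 1) | ∀ j, z j ∈ upperHS n} := by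
  simp only [ofPred_forall]
  exact isOpen_iInter_of_finite fun j => isOpen_upperHS.preimage (continuous_apply j)

lemma HarmonicOnM.sum_fderiv_fderiv_comp_blockEquiv {f : (Fin m → Euc (n + 1)) → ℝ}
    (hf : HarmonicOnM f) {x : EuclideanSpace ℝ (Fin m × Fin (n + 1))}
    (hx : ∀ j, blockEquiv n m x j ∈ upperHS n) :
    ∑ k, fderiv ℝ (fderiv ℝ (f ∘ blockEquiv n m)) x (EuclideanSpace.basisFun _ ℝ k)
      (EuclideanSpace.basisFun _ ℝ k) = 0 := by
  rw [← hf.2 _ hx, Fintype.sum_prod_type]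
  refine Finset.sum_congr rfl fun j _ => Finset.sum_congr rfl fun i _ => ?_
  have h := ContinuousLinearEquiv.iteratedFDerivWithin_comp_right (𝕜 := ℝ) (blockEquiv n m) f
    uniqueDiffOn_univ (x := x) (mem_univ _) 2
  rw [preimage_univ, iteratedFDerivWithin_univ, iteratedFDerivWithin_univ] at h
  have h2 := iteratedFDeriv_two_apply (𝕜 := ℝ) (f ∘ blockEquiv n m) x
    ![EuclideanSpace.basisFun _ ℝ (j, i), EuclideanSpace.basisFun _ ℝ (j, i)]
  simp only [Matrix.cons_val_zero, Matrix.cons_val_one] at h2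
  rw [← h2, h, ContinuousMultilinearMap.compContinuousLinearMap_apply, d2]
  congr 1
  funext k
  fin_cases k <;> simp [blockEquiv_single]

/-- A box around `w`, of size comparable to the height of `w`. -/
def heightBox (w : Euc (n + 1)) : Set (Euc n × ℝ) :=
  {z | (∀ i, |z.1 i - w i.castSucc| < tp w / 4) ∧ |z.2 - tp w| < tp w / 4}

lemma isOpen_heightBox_uncurry :
    IsOpen {q : Euc (n + 1) × (Fin m → Euc n × ℝ) | ∀ j, q.2 j ∈ heightBox q.1} := by
  have h : {q : Euc (n + 1) × (Fin m → Euc n × ℝ) | ∀ j, q.2 j ∈ heightBox q.1} =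
      ⋂ j, ((⋂ i : Fin n, {q | |(q.2 j).1 i - q.1 i.castSucc| < q.1 (Fin.last n) / 4}) ∩
        {q | |(q.2 j).2 - q.1 (Fin.last n)| < q.1 (Fin.last n) / 4}) := by
    ext q
    simp [heightBox, tp]
  rw [h]
  exact isOpen_iInter_of_finite fun j => IsOpen.inter
    (isOpen_iInter_of_finite fun i => isOpen_lt (by fun_prop) (by fun_prop))
    (isOpen_lt (by fun_prop) (by fun_prop))

lemma isOpen_heightBox (w : Euc (n + 1)) : IsOpen (heightBox w) := by
  have := (isOpen_heightBox_uncurry (n := n) (m := 1)).preimage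
    (f := fun z : Euc n × ℝ => (w, fun _ => z)) (by fun_prop)
  simpa using this

lemma snd_bounds_of_mem_heightBox {w : Euc (n + 1)} {z : Euc n × ℝ} (hz : z ∈ heightBox w) :
    3 / 4 * tp w < z.2 ∧ z.2 < 5 / 4 * tp w := by
  have := abs_lt.1 hz.2
  constructor <;> linarith

lemma mem_Qcube_of_mem_heightBox {w : Euc (n + 1)} {z : Euc n × ℝ} (hw : w ∈ upperHS n)
    (hz : z ∈ heightBox w) : w ∈ Qcube z.1 z.2 := by
  have hw' : 0 < tp w := hw
  have := snd_bounds_of_mem_heightBox hz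
  refine ⟨fun i => ?_, ?_⟩
  · rw [abs_sub_comm]; linarith [hz.1 i]
  · rw [abs_sub_comm]; linarith [hz.2]

lemma isClosed_Qcube (y : Euc n) (s : ℝ) : IsClosed (Qcube y s) := by
  have h : Qcube y s = (⋂ i : Fin n, {z | |z i.castSucc - y i| ≤ s / 2}) ∩
      {z | |z (Fin.last n) - s| ≤ s / 2} := by
    ext z
    simp [Qcube, tp]
  rw [h]
  exact (isClosed_iInter fun i => isClosed_le (by fun_prop) (by fun_prop)).inter
    (isClosed_le (by fun_prop) (by fun_prop))

lemma Qcube_mem_nhds {w : Euc (n + 1)} (hw : w ∈ upperHS n) : Qcube (xp w) (tp w) ∈ 𝓝 w := by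
  have hw' : 0 < tp w := hw
  have h (i : Fin (n + 1)) : ∀ᶠ z : Euc (n + 1) in 𝓝 w, |z i - w i| < tp w / 2 := by
    have hc : Continuous fun z : Euc (n + 1) => |z i - w i| := by fun_prop
    refine (hc.tendsto w).eventually_lt_const ?_
    simpa using hw'
  filter_upwards [Filter.eventually_all.2 h] with z hz
  exact ⟨fun i => (hz i.castSucc).le, (hz (Fin.last n)).le⟩

lemma sigmaFinite_restrict_upperHS {μ : Measure (Euc (n + 1))}
    (hμ : ∀ (y : Euc n) (r : ℝ), 0 < r → μ (Qcube y r) < ∞) :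
    SigmaFinite (μ.restrict (upperHS n)) := by
  obtain ⟨t, ht, htc, hcov⟩ := TopologicalSpace.countable_cover_nhdsWithin
    (s := upperHS n) (f := fun w => Qcube (xp w) (tp w))
    fun w hw => mem_nhdsWithin_of_mem_nhds (Qcube_mem_nhds hw)
  refine Measure.sigmaFinite_of_countable
    (S := insert (upperHS n)ᶜ ((fun w => Qcube (xp w) (tp w)) '' t)) ((htc.image _).insert _) ?_ ?_
  · rintro _ (rfl | ⟨w, hw, rfl⟩)
    · simp [Measure.restrict_apply isOpen_upperHS.measurableSet.compl]
    · exact (Measure.restrict_apply_le _ _).trans_lt (hμ _ _ (ht hw))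
  · refine eq_univ_of_forall fun w => ?_
    by_cases hw : w ∈ upperHS n
    · obtain ⟨v, hv, hwv⟩ := mem_iUnion₂.1 (hcov hw)
      exact ⟨_, mem_insert_of_mem _ ⟨v, hv, rfl⟩, hwv⟩
    · exact ⟨_, mem_insert _ _, hw⟩

lemma restrict_heightBox_le_smul_mLam {w : Euc (n + 1)} (hw : w ∈ upperHS n) (l : ℝ) :
    (volume : Measure (Euc n × ℝ)).restrict (heightBox w) ≤
      (2 ^ |l| * tp w ^ (-l)).toNNReal • mLam n l := by
  have hw' : 0 < tp w := hw
  refine Measure.le_iff.2 fun s hs => ?_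
  have hbox := (isOpen_heightBox w).measurableSet
  rw [Measure.restrict_apply hs, Measure.smul_apply, ENNReal.smul_def, smul_eq_mul]
  have hmeas : MeasurableSet (s ∩ heightBox w) := hs.inter hbox
  have hsub : s ∩ heightBox w ⊆ univ ×ˢ Ioi 0 := fun z hz =>
    ⟨mem_univ _, by
      have := snd_bounds_of_mem_heightBox hz.2
      rw [mem_Ioi]; linarith⟩
  calc volume (s ∩ heightBox w)
      = ∫⁻ z in s ∩ heightBox w, 1 ∂(volume.prod (volume.restrict (Ioi 0))) := by
        rw [setLIntegral_one, ← Measure.restrict_univ (μ := (volume : Measure (Euc n))),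
          Measure.prod_restrict, Measure.restrict_apply hmeas, inter_eq_left.2 hsub]
        rfl
    _ ≤ ∫⁻ z in s ∩ heightBox w, ((2 ^ |l| * tp w ^ (-l)).toNNReal : ℝ≥0∞) *
          ENNReal.ofReal (z.2 ^ l) ∂(volume.prod (volume.restrict (Ioi 0))) := by
        refine setLIntegral_mono' hmeas fun z hz => ?_
        have hz' := snd_bounds_of_mem_heightBox hz.2
        have h := rpow_le_two_rpow_abs_mul_rpow l hw' (t := z.2) (by linarith) (by linarith)
          (by linarith)
        rw [← ENNReal.ofReal, ← ENNReal.ofReal_mul (by positivity), ENNReal.one_le_ofReal,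
          Real.rpow_neg hw'.le]
        have := Real.rpow_pos_of_pos hw' l
        rw [mul_right_comm, ← div_eq_mul_inv, one_le_div this]
        exact h
    _ = ((2 ^ |l| * tp w ^ (-l)).toNNReal : ℝ≥0∞) * mLam n l (s ∩ heightBox w) := by
        rw [lintegral_const_mul' _ _ ENNReal.coe_ne_top, mLam, withDensity_apply _ hmeas]
    _ ≤ _ := by gcongr; exact inter_subset_left

/-- Sub-mean-value inequality on products of boxes for functions harmonic on a product of
half-spaces. -/
lemma exists_ofReal_abs_rpow_le_lintegral_heightBox (hm : 1 ≤ m) {p : ℝ} (hp : 0 < p) :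
    ∃ K : ℝ, 0 < K ∧ ∀ f : (Fin m → Euc (n + 1)) → ℝ, HarmonicOnM f → ∀ w ∈ upperHS n,
      ENNReal.ofReal (|f fun _ => w| ^ p) ≤ ENNReal.ofReal (K * (tp w ^ (m * (n + 1)))⁻¹) *
        ∫⁻ z in univ.pi fun _ => heightBox w,
          ENNReal.ofReal (|f fun j => pt (z j).1 (z j).2| ^ p) := by
  have : NeZero m := ⟨by omega⟩
  have : (volume : Measure (Euc n × ℝ)).IsAddHaarMeasure :=
    inferInstanceAs (volume.prod volume).IsAddHaarMeasure
  have : (volume : Measure (Fin m → Euc n × ℝ)).IsAddHaarMeasure :=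
    Measure.pi.isAddHaarMeasure fun _ : Fin m => (volume : Measure (Euc n × ℝ))
  let T := blockPairEquiv n m
  let A := blockEquiv n m
  let μ : Measure (EuclideanSpace ℝ (Fin m × Fin (n + 1))) := Measure.map T.symm volume
  have : μ.IsAddHaarMeasure := T.symm.isAddHaarMeasure_map volume
  obtain ⟨K, hK, hsub⟩ := exists_abs_rpow_le_integral_abs_rpow_of_harmonic μ
    (EuclideanSpace.basisFun (Fin m × Fin (n + 1)) ℝ) hp
  refine ⟨K * 8 ^ (m * (n + 1)), by positivity, fun f hf w hw => ?_⟩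
  have hw' : 0 < tp w := hw
  let a : EuclideanSpace ℝ (Fin m × Fin (n + 1)) := A.symm fun _ => w
  have hcoord : ∀ x ∈ Metric.closedBall a (tp w / 8), ∀ j i, |A x j i - w i| < tp w / 4 := by
    intro x hx j i
    rw [Metric.mem_closedBall, dist_eq_norm] at hx
    have h := (PiLp.norm_apply_le (x - a) (j, i)).trans hx
    rw [Real.norm_eq_abs] at h
    exact lt_of_le_of_lt h (by linarith)
  set U := A ⁻¹' {z | ∀ j, z j ∈ upperHS n}
  have hU : Metric.closedBall a (tp w / 8) ⊆ U := fun x hx j => by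
    have := abs_lt.1 (hcoord x hx j (Fin.last n))
    change 0 < A x j (Fin.last n)
    change 0 < w (Fin.last n) at hw'
    change _ < _ - w _ ∧ _ at this
    simp only [tp] at this
    linarith [this.1]
  have hUo : IsOpen U := isOpen_pi_upperHS.preimage A.continuous
  have hfA : ContDiffOn ℝ 2 (f ∘ A) U := hf.1.comp A.contDiff.contDiffOn fun _ h => h
  have key := hsub (f ∘ A) U hUo hfA (fun x hx => hf.sum_fderiv_fderiv_comp_blockEquiv hx)
    a (tp w / 8) (by positivity) hU
  have hfa : (f ∘ A) a = f fun _ => w := by simp [a]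
  have hdim : Module.finrank ℝ (EuclideanSpace ℝ (Fin m × Fin (n + 1))) = m * (n + 1) := by simp
  rw [hfa, hdim] at key
  have hfi : IntegrableOn (fun x => |(f ∘ A) x| ^ p) (Metric.ball a (tp w / 8)) μ :=
    (((hfA.continuousOn.abs.rpow_const fun _ _ => Or.inr hp.le).mono hU).integrableOn_compact
      (isCompact_closedBall _ _)).mono_set Metric.ball_subset_closedBall
  have hreal : |f fun _ => w| ^ p ≤ K * 8 ^ (m * (n + 1)) * (tp w ^ (m * (n + 1)))⁻¹ *
      ∫ x in Metric.ball a (tp w / 8), |(f ∘ A) x| ^ p ∂μ := by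
    rw [div_pow, mul_div_assoc', div_le_iff₀ (by positivity)] at key
    rw [mul_right_comm, ← div_eq_mul_inv, le_div_iff₀ (by positivity)]
    linarith
  refine (ENNReal.ofReal_le_ofReal hreal).trans ?_
  rw [ENNReal.ofReal_mul (by positivity), ofReal_integral_eq_lintegral_ofReal hfi
    (Filter.Eventually.of_forall fun x => by positivity)]
  gcongr
  have hTm : MeasurableEmbedding T.symm :=
    T.symm.toHomeomorph.measurableEmbedding
  rw [hTm.restrict_map, hTm.lintegral_map]
  refine lintegral_mono_set fun z hz j _ => ?_
  have h := hcoord _ (Metric.ball_subset_closedBall hz) j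
  simp only [A, T, blockEquiv_blockPairEquiv_symm] at h
  exact ⟨fun i => by simpa using h i.castSucc, by simpa [tp] using h (Fin.last n)⟩

lemma setLIntegral_heightBox_le (s : Fin m → ℝ) {w : Euc (n + 1)} (hw : w ∈ upperHS n)
    (F : (Fin m → Euc n × ℝ) → ℝ≥0∞) :
    ∫⁻ z in univ.pi fun _ => heightBox w, F z ≤
      ENNReal.ofReal ((∏ j, 2 ^ |s j|) * tp w ^ (-∑ j, s j)) *
        ∫⁻ z in univ.pi fun _ => heightBox w, F z ∂(Measure.pi fun j => mLam n (s j)) := by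
  have hw' : 0 < tp w := hw
  have hle := pi_le_prod_smul_pi fun j => restrict_heightBox_le_smul_mLam hw (s j)
  rw [← Measure.restrict_pi_pi] at hle
  have hc : ((∏ j, (2 ^ |s j| * tp w ^ (-s j)).toNNReal : ℝ≥0) : ℝ≥0∞) =
      ENNReal.ofReal ((∏ j, 2 ^ |s j|) * tp w ^ (-∑ j, s j)) := by
    rw [← Finset.sum_neg_distrib, Real.rpow_sum_of_pos hw', ← Finset.prod_mul_distrib,
      ENNReal.ofReal_prod_of_nonneg fun j _ => by positivity, ENNReal.ofNNReal_finsetProd]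
    rfl
  have hbox : MeasurableSet (univ.pi fun _ : Fin m => heightBox w) :=
    MeasurableSet.univ_pi fun _ => (isOpen_heightBox w).measurableSet
  have hle' := Measure.restrict_mono_measure hle (univ.pi fun _ => heightBox w)
  rw [Measure.restrict_restrict hbox, inter_self, Measure.restrict_smul] at hle'
  refine (lintegral_mono' hle' le_rfl).trans_eq ?_
  rw [lintegral_smul_measure, ENNReal.smul_def, hc, smul_eq_mul]

/-- Pointwise bound on the diagonal by an average over the product of boxes, with respect to the
product of the weighted measures. -/
lemma exists_ofReal_abs_rpow_le_lintegral_pi_mLam (hm : 1 ≤ m) {p : ℝ} (hp : 0 < p)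
    (s : Fin m → ℝ) :
    ∃ K : ℝ, 0 < K ∧ ∀ f : (Fin m → Euc (n + 1)) → ℝ, HarmonicOnM f → ∀ w ∈ upperHS n,
      ENNReal.ofReal (|f fun _ => w| ^ p) ≤
        ENNReal.ofReal (K * tp w ^ (-((m * (n + 1) : ℝ) + ∑ j, s j))) *
          ∫⁻ z in univ.pi fun _ => heightBox w,
            ENNReal.ofReal (|f fun j => pt (z j).1 (z j).2| ^ p)
            ∂(Measure.pi fun j => mLam n (s j)) := by
  obtain ⟨K, hK, hsub⟩ := exists_ofReal_abs_rpow_le_lintegral_heightBox (n := n) hm hp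
  refine ⟨K * ∏ j, 2 ^ |s j|, by positivity, fun f hf w hw => ?_⟩
  have hw' : 0 < tp w := hw
  refine (hsub f hf w hw).trans ?_
  refine (mul_le_mul_right (setLIntegral_heightBox_le s hw _) _).trans_eq ?_
  rw [← mul_assoc, ← ENNReal.ofReal_mul (by positivity)]
  congr 2
  rw [neg_add, Real.rpow_add hw', Real.rpow_neg hw'.le (m * (n + 1))]
  have : tp w ^ ((m : ℝ) * (n + 1)) = tp w ^ (m * (n + 1)) := by
    rw [← Real.rpow_natCast]; push_cast; rfl
  rw [this]
  ring

lemma measurable_indicator_abs_rpow {f : (Fin m → Euc (n + 1)) → ℝ} (hf : HarmonicOnM f) {p : ℝ}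
    (hp : 0 < p) :
    Measurable ({z : Fin m → Euc n × ℝ | ∀ j, 0 < (z j).2}.indicator fun z =>
      ENNReal.ofReal (|f fun j => pt (z j).1 (z j).2| ^ p)) := by
  have hD : IsOpen {z : Fin m → Euc n × ℝ | ∀ j, 0 < (z j).2} := by
    simp only [ofPred_forall]
    exact isOpen_iInter_of_finite fun j => isOpen_lt continuous_const (by fun_prop)
  have hpt : Continuous fun (z : Fin m → Euc n × ℝ) j => pt (z j).1 (z j).2 :=
    continuous_pi fun j => continuous_pt.comp (continuous_apply j)
  have hcont : ContinuousOn (fun z : Fin m → Euc n × ℝ => |f fun j => pt (z j).1 (z j).2| ^ p)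
      {z | ∀ j, 0 < (z j).2} :=
    (hf.1.continuousOn.comp hpt.continuousOn fun z hz j => by
      simpa [upperHS, tp] using hz j).abs.rpow_const fun _ _ => Or.inr hp.le
  rw [← piecewise_eq_indicator]
  exact (ENNReal.continuous_ofReal.comp_continuousOn hcont).measurable_piecewise
    continuousOn_const hD.measurableSet

/-- The mass of the weight over the points whose box contains a given point is bounded. -/
lemma setLIntegral_rpow_neg_le {μ : Measure (Euc (n + 1))} {C θ K : ℝ} (hK : 0 < K)
    (hμ : ∀ (y : Euc n) (r : ℝ), 0 < r → μ (Qcube y r) ≤ ENNReal.ofReal (C * r ^ θ))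
    {z : Euc n × ℝ} (hz : 0 < z.2) :
    ∫⁻ w in upperHS n, {w | z ∈ heightBox w}.indicator
        (fun w => ENNReal.ofReal (K * tp w ^ (-θ))) w ∂μ ≤
      ENNReal.ofReal (K * 2 ^ |θ| * C) := by
  have hQ := (isClosed_Qcube z.1 z.2).measurableSet
  calc ∫⁻ w in upperHS n, {w | z ∈ heightBox w}.indicator
        (fun w => ENNReal.ofReal (K * tp w ^ (-θ))) w ∂μ
      ≤ ∫⁻ w in upperHS n, (Qcube z.1 z.2).indicator
          (fun _ => ENNReal.ofReal (K * (2 ^ |θ| * z.2 ^ (-θ)))) w ∂μ := by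
        refine setLIntegral_mono' isOpen_upperHS.measurableSet fun w hw => ?_
        have hw' : 0 < tp w := hw
        by_cases hzw : z ∈ heightBox w
        · rw [indicator_of_mem (show w ∈ {w | z ∈ heightBox w} from hzw),
            indicator_of_mem (mem_Qcube_of_mem_heightBox hw hzw)]
          have h := snd_bounds_of_mem_heightBox hzw
          have := rpow_le_two_rpow_abs_mul_rpow (-θ) hw' hz (by linarith) (by linarith)
          rw [abs_neg] at this
          gcongr
        · rw [indicator_of_notMem (show w ∉ {w | z ∈ heightBox w} from hzw)]
          exact zero_le
    _ ≤ ∫⁻ w, (Qcube z.1 z.2).indicator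
          (fun _ => ENNReal.ofReal (K * (2 ^ |θ| * z.2 ^ (-θ)))) w ∂μ := setLIntegral_le_lintegral _ _
    _ = ENNReal.ofReal (K * (2 ^ |θ| * z.2 ^ (-θ))) * μ (Qcube z.1 z.2) :=
        lintegral_indicator_const hQ _
    _ ≤ ENNReal.ofReal (K * (2 ^ |θ| * z.2 ^ (-θ))) * ENNReal.ofReal (C * z.2 ^ θ) := by
        gcongr
        exact hμ _ _ hz
    _ = ENNReal.ofReal (K * 2 ^ |θ| * C) := by
        rw [← ENNReal.ofReal_mul (by positivity), Real.rpow_neg hz.le]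
        have := (Real.rpow_pos_of_pos hz θ).ne'
        congr 1
        field_simp

end HalfSpace

/-- Carleson condition implies the trace inequality. -/
theorem stmt0 (n m : ℕ) (hn : 1 ≤ n) (hm : 1 ≤ m) (p : ℝ) (hp : 0 < p)
    (s : Fin m → ℝ) (hs : ∀ j, -1 < s j)
    (μ : Measure (Euc (n + 1)))
    (C : ℝ) (hC : 0 < C)
    (hmu : ∀ (y : Euc n) (r : ℝ), 0 < r →
      μ (Qcube y r) ≤ ENNReal.ofReal (C * r ^ ((m * (n + 1) : ℝ) + ∑ j, s j))) :
    ∃ C' : ℝ, 0 < C' ∧ ∀ f : (Fin m → Euc (n + 1)) → ℝ, HarmonicOnM f →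
      (∫⁻ z in upperHS n, ENNReal.ofReal (|f (fun _ => z)| ^ p) ∂μ) ≤
        ENNReal.ofReal C' *
          ∫⁻ z : Fin m → (Euc n × ℝ),
            ENNReal.ofReal (|f (fun j => pt (z j).1 (z j).2)| ^ p)
            ∂(Measure.pi fun j => mLam n (s j)) := by
  obtain ⟨K, hK, hsub⟩ := exists_ofReal_abs_rpow_le_lintegral_pi_mLam (n := n) hm hp s
  set θ := (m * (n + 1) : ℝ) + ∑ j, s j
  refine ⟨K * 2 ^ |θ| * C, by positivity, fun f hf => ?_⟩
  have : SigmaFinite (μ.restrict (upperHS n)) :=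
    sigmaFinite_restrict_upperHS fun y r hr => (hmu y r hr).trans_lt ENNReal.ofReal_lt_top
  let D : Set (Fin m → Euc n × ℝ) := {z | ∀ j, 0 < (z j).2}
  let F : (Fin m → Euc n × ℝ) → ℝ≥0∞ := fun z =>
    ENNReal.ofReal (|f fun j => pt (z j).1 (z j).2| ^ p)
  let S : Set (Euc (n + 1) × (Fin m → Euc n × ℝ)) := {q | ∀ j, q.2 j ∈ heightBox q.1}
  let φ : Euc (n + 1) → ℝ≥0∞ := fun w => ENNReal.ofReal (K * tp w ^ (-θ))
  let H : Euc (n + 1) → (Fin m → Euc n × ℝ) → ℝ≥0∞ := fun w z =>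
    S.indicator (fun q => φ q.1 * D.indicator F q.2) (w, z)
  have hφ : Measurable φ :=
    ENNReal.measurable_ofReal.comp ((continuous_tp.measurable.pow_const _).const_mul _)
  have hG : Measurable (D.indicator F) := measurable_indicator_abs_rpow hf hp
  have hH : Measurable (Function.uncurry H) :=
    ((hφ.comp measurable_fst).mul (hG.comp measurable_snd)).indicator
      isOpen_heightBox_uncurry.measurableSet
  calc ∫⁻ w in upperHS n, ENNReal.ofReal (|f fun _ => w| ^ p) ∂μ
      ≤ ∫⁻ w in upperHS n, ∫⁻ z, H w z ∂(Measure.pi fun j => mLam n (s j)) ∂μ := by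
        refine setLIntegral_mono' isOpen_upperHS.measurableSet fun w hw => ?_
        have hw' : 0 < tp w := hw
        refine (hsub f hf w hw).trans_eq ?_
        rw [← lintegral_indicator
            (MeasurableSet.univ_pi fun _ => (isOpen_heightBox w).measurableSet),
          ← lintegral_const_mul' _ _ ENNReal.ofReal_ne_top]
        refine lintegral_congr fun z => ?_
        by_cases hz : ∀ j, z j ∈ heightBox w
        · have hzD : z ∈ D := fun j => by
            have := snd_bounds_of_mem_heightBox (hz j)
            linarith
          simp only [H, indicator_of_mem (show (w, z) ∈ S from hz), indicator_of_mem hzD]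
          rw [indicator_of_mem (by simpa using hz)]
        · simp only [H, indicator_of_notMem (show (w, z) ∉ S from hz)]
          rw [indicator_of_notMem (by simpa using hz), mul_zero]
    _ = ∫⁻ z, ∫⁻ w in upperHS n, H w z ∂μ ∂(Measure.pi fun j => mLam n (s j)) :=
        lintegral_lintegral_swap hH.aemeasurable
    _ ≤ ∫⁻ z, ENNReal.ofReal (K * 2 ^ |θ| * C) * F z ∂(Measure.pi fun j => mLam n (s j)) := by
        refine lintegral_mono fun z => ?_
        by_cases hz : z ∈ D
        · calc ∫⁻ w in upperHS n, H w z ∂μ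
              ≤ ∫⁻ w in upperHS n, {w | z ⟨0, hm⟩ ∈ heightBox w}.indicator φ w * F z ∂μ := by
                refine lintegral_mono fun w => ?_
                by_cases hzw : ∀ j, z j ∈ heightBox w
                · simp only [H, indicator_of_mem (show (w, z) ∈ S from hzw), indicator_of_mem hz]
                  rw [indicator_of_mem (show w ∈ {w | z ⟨0, hm⟩ ∈ heightBox w} from hzw _)]
                · simp only [H, indicator_of_notMem (show (w, z) ∉ S from hzw)]
                  exact zero_le
            _ = (∫⁻ w in upperHS n, {w | z ⟨0, hm⟩ ∈ heightBox w}.indicator φ w ∂μ) * F z :=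
                lintegral_mul_const' _ _ ENNReal.ofReal_ne_top
            _ ≤ _ := by
                gcongr
                exact setLIntegral_rpow_neg_le hK hmu (hz _)
        · have hHz (w : Euc (n + 1)) : H w z = 0 := by
            simp only [H, indicator_apply_eq_zero, indicator_of_notMem hz, mul_zero, implies_true]
          simp [hHz]
    _ = _ := lintegral_const_mul' _ _ ENNReal.ofReal_ne_top

end
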